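/- arXiv:1709.02408 — 2 statements merged into one kernel-verified Lean document; each statement's English description precedes it below -/
import Mathlib

section
/- The pseudointersection number 𝔭 equals the tower number 𝔱. -/
open Cardinal Set

/-- `A ⊆* B` : `A \ B` is finite. -/
def AlmostSubset (A B : Set ℕ) : Prop := (A \ B).Finite

/-- Strong finite intersection property: every nonempty finite subfamily has
infinite intersection. -/
def SFIP (F : Set (Set ℕ)) : Prop :=
  ∀ G : Finset (Set ℕ), ↑G ⊆ F → G.Nonempty → Set.Infinite (⋂ A ∈ G, A)

/-- `F` has an infinite pseudointersection. -/
def HasPseudointersection (F : Set (Set ℕ)) : Prop :=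
  ∃ A : Set ℕ, A.Infinite ∧ ∀ B ∈ F, AlmostSubset A B

/-- The pseudointersection number `𝔭`. -/
noncomputable def pseudoNum : Cardinal :=
  sInf { c | ∃ F : Set (Set ℕ), (∀ A ∈ F, A.Infinite) ∧ SFIP F ∧
    ¬ HasPseudointersection F ∧ c = #↥F }

/-- The tower number `𝔱`: least cardinality of a family of infinite subsets of `ℕ`
linearly ordered by `⊇*` with no pseudointersection. -/
noncomputable def towerNum : Cardinal :=
  sInf { c | ∃ F : Set (Set ℕ), (∀ A ∈ F, A.Infinite) ∧
    (∀ A ∈ F, ∀ B ∈ F, AlmostSubset A B ∨ AlmostSubset B A) ∧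
    ¬ HasPseudointersection F ∧ c = #↥F }

open Filter

/-! ### Almost inclusion -/

/-- The filter of properties holding at almost all elements of `A`. -/
def tail (A : Set ℕ) : Filter ℕ := atTop ⊓ 𝓟 A

theorem eventually_tail {A : Set ℕ} {P : ℕ → Prop} :
    (∀ᶠ n in tail A, P n) ↔ ∀ᶠ n in atTop, n ∈ A → P n :=
  eventually_inf_principal

theorem eventually_tail_mem (A : Set ℕ) : ∀ᶠ n in tail A, n ∈ A :=
  eventually_tail.2 (Eventually.of_forall fun _ h => h)

theorem tail_le_atTop (A : Set ℕ) : tail A ≤ atTop := inf_le_left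

theorem Set.Infinite.neBot_tail {A : Set ℕ} (hA : A.Infinite) : (tail A).NeBot := by
  rw [tail, inf_principal_neBot_iff]
  intro U hU
  obtain ⟨n, hn⟩ := mem_atTop_sets.1 hU
  obtain ⟨m, hm, hnm⟩ := hA.exists_gt n
  exact ⟨m, hn m hnm.le, hm⟩

theorem Set.Infinite.frequently_of_tail {A : Set ℕ} (hA : A.Infinite) {P : ℕ → Prop}
    (h : ∀ᶠ n in tail A, P n) : ∃ᶠ n in atTop, P n :=
  have := hA.neBot_tail
  h.frequently.filter_mono (tail_le_atTop A)

theorem almostSubset_iff {A B : Set ℕ} : AlmostSubset A B ↔ ∀ᶠ n in tail A, n ∈ B := by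
  rw [eventually_tail, ← Nat.cofinite_eq_atTop, eventually_cofinite, AlmostSubset]
  simp only [Classical.not_imp]
  rfl

theorem AlmostSubset.tail_le {A B : Set ℕ} (h : AlmostSubset A B) : tail A ≤ tail B :=
  le_inf inf_le_left (le_principal_iff.2 (almostSubset_iff.1 h))

theorem AlmostSubset.trans {A B C : Set ℕ} (h : AlmostSubset A B) (h' : AlmostSubset B C) :
    AlmostSubset A C :=
  almostSubset_iff.2 ((almostSubset_iff.1 h').filter_mono h.tail_le)

theorem almostSubset_of_subset {A B : Set ℕ} (h : A ⊆ B) : AlmostSubset A B := by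
  simp [AlmostSubset, sdiff_eq_empty.2 h]

theorem AlmostSubset.infinite {A B : Set ℕ} (h : AlmostSubset A B) (hA : A.Infinite) :
    B.Infinite := fun hB =>
  hA ((hB.union h).subset fun x hx => by by_cases x ∈ B <;> simp_all)

/-! ### Recursion along a well-order -/

theorem exists_history {ι σ : Type*} [LinearOrder ι] [WellFoundedLT ι] [Nonempty σ]
    (P : ι → (ι → σ) → σ → Prop)
    (congr : ∀ i f f' x, (∀ j < i, f j = f' j) → P i f x → P i f' x)
    (ex : ∀ i f, (∀ j < i, P j f (f j)) → ∃ x, P i f x) : ∃ f, ∀ i, P i f (f i) := by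
  classical
  let hist (i : ι) (rec : ∀ j, j < i → σ) : ι → σ :=
    fun j => if h : j < i then rec j h else Classical.arbitrary σ
  let step (i : ι) (rec : ∀ j, j < i → σ) : σ := Classical.epsilon (P i (hist i rec))
  let F : ι → σ := (wellFounded_lt (α := ι)).fix step
  have hF : ∀ i, F i = step i fun j _ => F j := fun i => WellFounded.fix_eq _ _ _
  have hh : ∀ i, ∀ j < i, hist i (fun j _ => F j) j = F j := fun i j hj => by simp [hist, hj]
  refine ⟨F, fun i => ?_⟩
  induction i using WellFoundedLT.induction with
  | ind i ih =>
    refine congr i _ _ _ (hh i) ?_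
    rw [hF]
    refine Classical.epsilon_spec (ex i _ fun j hj => ?_)
    rw [hh i j hj]
    exact congr j _ _ _ (fun k hk => (hh i k (hk.trans hj)).symm) (ih j hj)

/-! ### Families below the two cardinals -/

theorem exists_pseudointersection_of_chain {ι : Type} (hι : #ι < towerNum) (S : ι → Set ℕ)
    (inf : ∀ i, (S i).Infinite)
    (chain : ∀ i j, AlmostSubset (S i) (S j) ∨ AlmostSubset (S j) (S i)) :
    ∃ A : Set ℕ, A.Infinite ∧ ∀ i, AlmostSubset A (S i) := by
  by_contra hno
  refine notMem_of_lt_csInf' (mk_range_le.trans_lt hι : #(range S) < towerNum)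
    ⟨range S, by simpa, by simpa, ?_, rfl⟩
  simpa [HasPseudointersection] using hno

theorem exists_pseudointersection_of_sfip {ι : Type} (hι : #ι < pseudoNum) (S : ι → Set ℕ)
    (inf : ∀ s : Finset ι, (⋂ i ∈ s, S i).Infinite) :
    ∃ A : Set ℕ, A.Infinite ∧ ∀ i, AlmostSubset A (S i) := by
  classical
  by_contra hno
  refine notMem_of_lt_csInf' (mk_range_le.trans_lt hι : #(range S) < pseudoNum)
    ⟨range S, fun A ⟨i, hi⟩ => by simpa [hi] using inf {i}, fun G hG _ => ?_, ?_, rfl⟩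
  · obtain ⟨s, -, rfl⟩ := Finset.subset_set_image_iff.1 (image_univ (f := S) ▸ hG)
    simpa using inf s
  · simpa [HasPseudointersection] using hno

theorem sfip_of_chain {F : Set (Set ℕ)} (inf : ∀ A ∈ F, A.Infinite)
    (chain : ∀ A ∈ F, ∀ B ∈ F, AlmostSubset A B ∨ AlmostSubset B A) : SFIP F := by
  classical
  intro G hG hne
  suffices ∃ A ∈ G, AlmostSubset A (⋂ B ∈ G, B) by
    obtain ⟨A, hA, h⟩ := this
    exact h.infinite (inf A (hG hA))
  induction hne using Finset.Nonempty.cons_induction with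
  | singleton A => exact ⟨A, by simp, almostSubset_of_subset (by simp)⟩
  | cons B G hB hne ih =>
    simp only [Finset.coe_cons, Set.insert_subset_iff] at hG
    obtain ⟨A, hA, h⟩ := ih hG.2
    simp only [Finset.mem_cons, iInter_iInter_eq_or_left]
    have key : ∀ {X Y Z : Set ℕ}, AlmostSubset X Y → AlmostSubset X Z → AlmostSubset X (Y ∩ Z) :=
      fun h h' => almostSubset_iff.2 ((almostSubset_iff.1 h).and (almostSubset_iff.1 h'))
    rcases chain A (hG.2 hA) B hG.1 with h' | h'
    · exact ⟨A, .inr hA, key h' h⟩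
    · exact ⟨B, .inl rfl, key (almostSubset_of_subset subset_rfl) (h'.trans h)⟩

theorem exists_tower : ∃ F : Set (Set ℕ), (∀ A ∈ F, A.Infinite) ∧
    (∀ A ∈ F, ∀ B ∈ F, AlmostSubset A B ∨ AlmostSubset B A) ∧ ¬ HasPseudointersection F := by
  let r : {A : Set ℕ // A.Infinite} → {A : Set ℕ // A.Infinite} → Prop :=
    fun A B => AlmostSubset A.1 B.1
  have hmax := maxChain_spec (r := r)
  refine ⟨Subtype.val '' maxChain r, ?_, ?_, ?_⟩
  · rintro _ ⟨A, -, rfl⟩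
    exact A.2
  · rintro _ ⟨A, hA, rfl⟩ _ ⟨B, hB, rfl⟩
    by_cases h : A = B
    · exact .inl (almostSubset_of_subset (h ▸ subset_rfl))
    · exact hmax.1 hA hB h
  · rintro ⟨A, hA, h⟩
    obtain ⟨C, D, hCD, hdisj, hcard⟩ := hA.exists_union_disjoint_cardinal_eq_of_infinite
    have hiff : C.Finite ↔ D.Finite := by
      rw [← Cardinal.lt_aleph0_iff_set_finite, ← Cardinal.lt_aleph0_iff_set_finite, hcard]
    have hC : C.Infinite := fun hC => hA (hCD ▸ hC.union (hiff.1 hC))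
    have hD : D.Infinite := fun hD => hC (hiff.2 hD)
    have hCr : ∀ B ∈ maxChain r, AlmostSubset C B := fun B hB =>
      (almostSubset_of_subset (hCD ▸ subset_union_left)).trans (h _ ⟨B, hB, rfl⟩)
    have hins : IsChain r (insert ⟨C, hC⟩ (maxChain r)) :=
      hmax.1.insert fun B hB _ => .inl (hCr B hB)
    have hmem : (⟨C, hC⟩ : {A : Set ℕ // A.Infinite}) ∈ maxChain r := by
      rw [hmax.2 hins (subset_insert _ _)]
      exact mem_insert _ _
    refine hD ((h _ ⟨_, hmem, rfl⟩).subset fun x hx => ⟨hCD ▸ .inr hx, fun hxC => ?_⟩)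
    exact disjoint_left.1 hdisj hxC hx

theorem pseudoNum_le_towerNum : pseudoNum ≤ towerNum := by
  obtain ⟨F, h₁, h₂, h₃⟩ := exists_tower
  refine le_csInf ⟨_, F, h₁, h₂, h₃, rfl⟩ ?_
  rintro _ ⟨F, h₁, h₂, h₃, rfl⟩
  exact csInf_le' ⟨F, h₁, sfip_of_chain h₁ h₂, h₃, rfl⟩

theorem aleph0_lt_pseudoNum : ℵ₀ < pseudoNum := by
  obtain ⟨F, h₁, h₂, h₃⟩ := exists_tower
  obtain ⟨F, h₁, h₂, h₃, h₄⟩ : pseudoNum ∈ { c | ∃ F : Set (Set ℕ), (∀ A ∈ F, A.Infinite) ∧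
      SFIP F ∧ ¬ HasPseudointersection F ∧ c = #↥F } :=
    csInf_mem ⟨_, F, h₁, sfip_of_chain h₁ h₂, h₃, rfl⟩
  rw [h₄, ← not_le, Cardinal.mk_le_aleph0_iff]
  intro hc
  refine h₃ ?_
  rcases F.eq_empty_or_nonempty with rfl | hne
  · exact ⟨univ, infinite_univ, by simp⟩
  obtain ⟨S, rfl⟩ := (Set.countable_coe_iff.1 hc).exists_eq_range hne
  have : ∀ k, ∃ a, k < a ∧ ∀ j ≤ k, a ∈ S j := fun k => by
    classical
    obtain ⟨a, ha, hk⟩ := (h₂ ((Finset.range (k + 1)).image S) (by simp) (by simp)).exists_gt k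
    exact ⟨a, hk, by simpa [Nat.lt_succ_iff] using ha⟩
  choose a hka ha using this
  refine ⟨range a, ?_, ?_⟩
  · refine Set.infinite_of_not_bddAbove fun ⟨b, hb⟩ => ?_
    exact (hka b).not_ge (hb ⟨b, rfl⟩)
  · rintro _ ⟨j, rfl⟩
    refine ((Finset.range j).image a).finite_toSet.subset ?_
    rintro _ ⟨⟨k, rfl⟩, hk⟩
    simp only [Finset.coe_image, Finset.coe_range]
    exact ⟨k, not_le.1 fun h => hk (ha k j h), rfl⟩

/-! ### Selecting values along an infinite set -/

theorem exists_selector_of_pseudointersection {V : Type} [Nonempty V] {ι : Type*}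
    (Q : ι → ℕ → V → Prop) (P : Set (ℕ × V)) (fin : ∀ k, {q ∈ P | q.1 < k}.Finite)
    (inf : P.Infinite) (hP : ∀ i, {q ∈ P | ¬ Q i q.1 q.2}.Finite) :
    ∃ N : Set ℕ, N.Infinite ∧ ∃ v : ℕ → V, ∀ i, ∀ᶠ n in tail N, Q i n (v n) := by
  classical
  have hv : ∀ n, ∃ v, n ∈ Prod.fst '' P → (n, v) ∈ P := by
    intro n
    by_cases h : n ∈ Prod.fst '' P
    · obtain ⟨q, hq, rfl⟩ := h
      exact ⟨q.2, fun _ => hq⟩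
    · exact ⟨Classical.arbitrary V, fun h' => absurd h' h⟩
  choose v hv using hv
  refine ⟨Prod.fst '' P, fun h => ?_, v, fun i => ?_⟩
  · obtain ⟨k, hk⟩ := h.bddAbove
    exact inf ((fin (k + 1)).subset fun q hq =>
      ⟨hq, Nat.lt_succ_of_le (hk (mem_image_of_mem _ hq))⟩)
  · exact (almostSubset_iff (B := {n | Q i n (v n)})).1
      (((hP i).image Prod.fst).subset fun n ⟨hn, hQ⟩ => ⟨(n, v n), ⟨hv n hn, hQ⟩, rfl⟩)

theorem exists_selector {V : Type} [Countable V] [Nonempty V] {ι : Type} (hι : #ι < pseudoNum)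
    (Q : ι → ℕ → V → Prop) (ex : ∀ s : Finset ι, ∃ᶠ n in atTop, ∃ v, ∀ i ∈ s, Q i n v) :
    ∃ N : Set ℕ, N.Infinite ∧ ∃ v : ℕ → V, ∀ i, ∀ᶠ n in tail N, Q i n (v n) := by
  classical
  obtain ⟨e, he⟩ := exists_injective_nat (ℕ × V)
  let S : ι ⊕ ℕ → Set (ℕ × V) := Sum.elim (fun i => {q | Q i q.1 q.2}) fun k => {q | k ≤ q.1}
  obtain ⟨A, hA, hAS⟩ := exists_pseudointersection_of_sfip (ι := Option (ι ⊕ ℕ))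
    (by
      have h := aleph0_lt_pseudoNum
      simp only [mk_option, mk_sum, lift_id, mk_nat]
      exact add_lt_of_lt h.le (add_lt_of_lt h.le hι h) (one_lt_aleph0.trans h))
    (fun o => e '' o.elim univ S) fun s => by
      let k := s.eraseNone.toRight.sup id
      have hinf : {q : ℕ × V | k ≤ q.1 ∧ ∀ i ∈ s.eraseNone.toLeft, Q i q.1 q.2}.Infinite := by
        refine Infinite.of_image Prod.fst ?_
        refine (Nat.frequently_atTop_iff_infinite.1
          ((ex s.eraseNone.toLeft).and_eventually (eventually_ge_atTop k))).mono ?_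
        rintro n ⟨⟨v, hv⟩, hn⟩
        exact ⟨(n, v), ⟨hn, hv⟩, rfl⟩
      refine (hinf.image he.injOn).mono ?_
      rintro _ ⟨q, ⟨hk, hq⟩, rfl⟩
      refine mem_iInter₂.2 fun o ho => ⟨q, ?_, rfl⟩
      rcases o with _ | i | l
      · trivial
      · exact hq i (by simpa using ho)
      · exact (Finset.le_sup (f := id) (by simpa using ho)).trans hk
  refine exists_selector_of_pseudointersection Q (e ⁻¹' A) (fun k => ?_) ?_ fun i => ?_
  · refine Finite.of_finite_image ((hAS (some (.inr k))).subset ?_) he.injOn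
    rintro _ ⟨q, ⟨hq, hk⟩, rfl⟩
    exact ⟨hq, fun h => hk.not_ge (he.mem_set_image.1 h)⟩
  · refine fun h => hA (((h.image e).union (hAS none)).subset fun a ha => ?_)
    by_cases hr : a ∈ range e
    · obtain ⟨q, rfl⟩ := hr
      exact .inl ⟨q, ha, rfl⟩
    · exact .inr ⟨ha, by simpa using hr⟩
  · refine Finite.of_finite_image ((hAS (some (.inl i))).subset ?_) he.injOn
    rintro _ ⟨q, ⟨hq, hk⟩, rfl⟩
    exact ⟨hq, fun h => hk (he.mem_set_image.1 h)⟩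

theorem exists_selector_of_chain {V : Type} [Countable V] [Nonempty V] {ι : Type}
    [LinearOrder ι] [Nonempty ι] (hι : #ι < towerNum) (Q : ι → ℕ → V → Prop)
    (fin : ∀ i n, {v | Q i n v}.Finite) (ex : ∀ i, ∃ᶠ n in atTop, ∃ v, Q i n v)
    (mono : ∀ i, ∀ j < i, ∀ᶠ n in atTop, ∀ v, Q i n v → Q j n v) :
    ∃ N : Set ℕ, N.Infinite ∧ ∃ v : ℕ → V, ∀ i, ∀ᶠ n in tail N, Q i n (v n) := by
  obtain ⟨e, he⟩ := exists_injective_nat (ℕ × V)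
  let S : ι → Set (ℕ × V) := fun i => {q | Q i q.1 q.2}
  have hfin : ∀ i k, {q ∈ S i | q.1 < k}.Finite := fun i k => by
    refine ((finite_lt_nat k).biUnion fun n _ => (fin i n).image (Prod.mk n)).subset ?_
    rintro ⟨n, v⟩ ⟨hq, hn⟩
    exact mem_biUnion hn ⟨v, hq, rfl⟩
  have hS : ∀ i, ∀ j < i, AlmostSubset (e '' S i) (e '' S j) := fun i j hj => by
    obtain ⟨k, hk⟩ := eventually_atTop.1 (mono i j hj)
    refine ((hfin i k).image e).subset ?_
    rintro _ ⟨⟨q, hq, rfl⟩, hq'⟩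
    refine ⟨q, ⟨hq, not_le.1 fun h => hq' ⟨q, hk _ h _ hq, rfl⟩⟩, rfl⟩
  obtain ⟨A, hA, hAS⟩ := exists_pseudointersection_of_chain hι (fun i => e '' S i)
    (fun i => by
      refine (Infinite.of_image Prod.fst ?_).image he.injOn
      refine (Nat.frequently_atTop_iff_infinite.1 (ex i)).mono ?_
      rintro n ⟨v, hv⟩
      exact ⟨(n, v), hv, rfl⟩)
    (fun i j => by
      rcases lt_trichotomy i j with h | rfl | h
      · exact .inr (hS _ _ h)
      · exact .inl (almostSubset_of_subset subset_rfl)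
      · exact .inl (hS _ _ h))
  have hbad : ∀ i, {q ∈ e ⁻¹' A | ¬ Q i q.1 q.2}.Finite := fun i => by
    refine Finite.of_finite_image ((hAS i).subset ?_) he.injOn
    rintro _ ⟨q, ⟨hq, hk⟩, rfl⟩
    exact ⟨hq, fun h => hk (he.mem_set_image.1 h)⟩
  have i₀ : ι := Classical.arbitrary ι
  refine exists_selector_of_pseudointersection Q (e ⁻¹' A) (fun k => ?_) (fun h => ?_) hbad
  · refine ((hbad i₀).union (hfin i₀ k)).subset fun q ⟨hq, hk⟩ => ?_
    by_cases h : Q i₀ q.1 q.2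
    · exact .inr ⟨h, hk⟩
    · exact .inl ⟨hq, h⟩
  · refine hA (((h.image e).union (hAS i₀)).subset fun a ha => ?_)
    by_cases hr : a ∈ e '' S i₀
    · obtain ⟨q, -, rfl⟩ := hr
      exact .inl ⟨q, ha, rfl⟩
    · exact .inr ⟨ha, hr⟩

/-! ### Dominating functions -/

theorem Set.Infinite.exists_sparse_subset {Y : Set ℕ} (hY : Y.Infinite) (h : ℕ → ℕ) :
    ∃ X ⊆ Y, X.Infinite ∧ ∀ a ∈ X, ∀ b ∈ X, a < b → ∀ k ≤ a, h k ≤ b := by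
  choose next hmem hlt using hY.exists_gt
  let x : ℕ → ℕ := Nat.rec (next 0) fun _ a => next (a + (Finset.range (a + 1)).sup h)
  have hx : ∀ p, x p + (Finset.range (x p + 1)).sup h < x (p + 1) := fun p => hlt _
  have hmono : StrictMono x := strictMono_nat_of_lt_succ fun p => by have := hx p; omega
  refine ⟨range x, ?_, infinite_range_of_injective hmono.injective, ?_⟩
  · rintro _ ⟨_ | p, rfl⟩
    exacts [hmem _, hmem _]
  · rintro _ ⟨p, rfl⟩ _ ⟨q, rfl⟩ hpq k hk
    have h₁ : h k ≤ (Finset.range (x p + 1)).sup h := Finset.le_sup (by simpa using by omega)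
    have h₂ := hmono.monotone (Nat.succ_le_of_lt (hmono.lt_iff_lt.1 hpq))
    have := hx p
    simp only [Nat.succ_eq_add_one] at h₂
    omega

theorem exists_dominating {ι : Type} (hι : #ι < towerNum) (h : ι → ℕ → ℕ) :
    ∃ H : ℕ → ℕ, ∀ i, ∀ᶠ n in atTop, h i n ≤ H n := by
  obtain ⟨_, _⟩ := exists_wellFoundedLT ι
  obtain ⟨X, hX⟩ := exists_history (σ := Set ℕ)
    (fun i f X => X.Infinite ∧ (∀ j < i, AlmostSubset X (f j)) ∧
      ∀ a ∈ X, ∀ b ∈ X, a < b → ∀ k ≤ a, h i k ≤ b)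
    (fun i f f' X hf ⟨h₁, h₂, h₃⟩ => ⟨h₁, fun j hj => hf j hj ▸ h₂ j hj, h₃⟩)
    (fun i f hf => by
      obtain ⟨Y, hY, hYf⟩ := exists_pseudointersection_of_chain
        ((mk_set_le (Iio i)).trans_lt hι) (fun j => f j.1) (fun j => (hf j.1 j.2).1)
        (fun j k => by
          rcases lt_trichotomy j.1 k.1 with hjk | hjk | hjk
          · exact .inr ((hf k.1 k.2).2.1 _ hjk)
          · exact .inl (almostSubset_of_subset (hjk ▸ subset_rfl))
          · exact .inl ((hf j.1 j.2).2.1 _ hjk))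
      obtain ⟨X, hXY, hX, hs⟩ := hY.exists_sparse_subset (h i)
      exact ⟨X, hX, fun j hj => (almostSubset_of_subset hXY).trans (hYf ⟨j, hj⟩), hs⟩)
  obtain ⟨A, hA, hAX⟩ := exists_pseudointersection_of_chain hι X (fun i => (hX i).1)
    (fun j k => by
      rcases lt_trichotomy j k with hjk | hjk | hjk
      · exact .inr ((hX k).2.1 _ hjk)
      · exact .inl (almostSubset_of_subset (hjk ▸ subset_rfl))
      · exact .inl ((hX j).2.1 _ hjk))
  choose next hmem hlt using hA.exists_gt
  refine ⟨fun n => next (next n), fun i => ?_⟩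
  obtain ⟨k, hk⟩ := eventually_atTop.1 (eventually_tail.1 (almostSubset_iff.1 (hAX i)))
  filter_upwards [eventually_ge_atTop k] with n hn
  have h₁ := hlt n
  have h₂ := hlt (next n)
  exact (hX i).2.2 _ (hk _ (by omega) (hmem _)) _ (hk _ (by omega) (hmem _)) h₂ n h₁.le

/-! ### Colourings of pairs -/

theorem exists_coloring {ι K : Type} [LinearOrder ι] [WellFoundedLT ι] [LinearOrder K]
    (hK : ℵ₀ ≤ #K) (hKI : ∀ i : K, #(Iio i) < #K) (hι : #K < #ι) :
    ∃ g : ι → ι → K, ∀ φ : ι → K, ∃ α β, α < β ∧ φ α = φ β ∧ φ α ≤ g α β := by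
  classical
  have : Nonempty K := mk_ne_zero_iff.1 (aleph0_pos.trans_le hK).ne'
  let L : Set ι := {β | #(Iio β) ≤ #K}
  have hL : #K < #L := by
    by_contra! hle
    have hne : Lᶜ.Nonempty := by
      rw [nonempty_compl]
      rintro hu
      rw [hu, mk_univ] at hle
      exact hle.not_gt hι
    refine wellFounded_lt.min_mem Lᶜ hne (le_trans (mk_le_mk_of_subset fun α hα => ?_) hle)
    exact not_not.1 fun h => wellFounded_lt.not_lt_min Lᶜ h hα
  have hg : ∀ β, ∃ g : ι → K, β ∈ L → InjOn g (Iio β) := fun β => by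
    by_cases hβ : β ∈ L
    · obtain ⟨e⟩ := Cardinal.le_def _ _ |>.1 (show #(Iio β) ≤ #K from hβ)
      refine ⟨fun α => if h : α < β then e ⟨α, h⟩ else Classical.arbitrary K, fun _ => ?_⟩
      intro α hα α' hα' h
      simp only [mem_Iio] at hα hα'
      simp only [mem_Iio.1 hα, mem_Iio.1 hα', dite_true] at h
      exact congrArg Subtype.val (e.injective h)
    · exact ⟨fun _ => Classical.arbitrary K, fun h => absurd h hβ⟩
  choose g hg using hg
  refine ⟨fun α β => g β α, fun φ => ?_⟩
  obtain ⟨i, hi⟩ := infinite_pigeonhole_card_lt (fun α : L => φ α) hL (hK.trans hL.le)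
  obtain ⟨Z, hZ⟩ := le_mk_iff_exists_set.1 hi.le
  obtain ⟨β, hβ⟩ : ∃ β : (fun α : L => φ α) ⁻¹' {i}, ∀ z ∈ Z, z < β := by
    by_contra! hcof
    have hsub : (univ : Set ((fun α : L => φ α) ⁻¹' {i})) ⊆ ⋃ z ∈ Z, Iic z := fun β _ => by
      obtain ⟨z, hz, hβz⟩ := hcof β
      exact mem_biUnion hz hβz
    have hIic : ∀ z : (fun α : L => φ α) ⁻¹' {i}, #(Iic z) ≤ #K := fun z => by
      have h₁ : #(Iic z) ≤ #(Iic z.1.1) := by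
        refine mk_le_of_injective (f := fun x => ⟨x.1.1.1, x.2⟩) fun x y hxy => ?_
        simpa [Subtype.ext_iff] using hxy
      refine h₁.trans ?_
      rw [← Iio_insert]
      exact mk_insert_le.trans (add_le_of_le hK z.1.2 (one_le_aleph0.trans hK))
    have hle := (mk_le_mk_of_subset hsub).trans (mk_biUnion_le _ _)
    rw [mk_univ, hZ] at hle
    refine hi.not_ge (hle.trans ?_)
    exact (mul_le_mul_right (ciSup_le' fun z : Z => hIic z) _).trans (mul_eq_self hK).le
  obtain ⟨z, hz, hiz⟩ : ∃ z ∈ Z, i ≤ g β.1 z.1 := by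
    by_contra! hlt
    refine (hKI i).not_ge (hZ ▸ mk_le_of_injective (f := fun z : Z => ⟨_, hlt z.1 z.2⟩) ?_)
    intro z z' h
    have h' := hg β.1 β.1.2 (hβ _ z.2) (hβ _ z'.2) (Subtype.ext_iff.1 h)
    exact Subtype.ext (Subtype.ext (Subtype.ext h'))
  refine ⟨z.1, β.1, hβ z hz, ?_, ?_⟩
  · exact z.2.trans β.2.symm
  · exact (show φ z.1 = i from z.2).trans_le hiz

/-! ### From a family without pseudointersection to a gap -/

theorem exists_directed_family : ∃ A : pseudoNum.ord.ToType → Set ℕ, (∀ α, (A α).Infinite) ∧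
    (∀ α β, ∃ γ, A γ ⊆ A α ∩ A β) ∧ ¬ ∃ X : Set ℕ, X.Infinite ∧ ∀ α, AlmostSubset X (A α) := by
  classical
  obtain ⟨F, h₁, h₂, h₃⟩ := exists_tower
  obtain ⟨F, h₁, h₂, h₃, h₄⟩ : pseudoNum ∈ { c | ∃ F : Set (Set ℕ), (∀ A ∈ F, A.Infinite) ∧
      SFIP F ∧ ¬ HasPseudointersection F ∧ c = #↥F } :=
    csInf_mem ⟨_, F, h₁, sfip_of_chain h₁ h₂, h₃, rfl⟩
  have : Infinite F := Cardinal.infinite_iff.2 (h₄ ▸ aleph0_lt_pseudoNum.le)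
  obtain ⟨e⟩ : Nonempty (pseudoNum.ord.ToType ≃ Finset F) :=
    Cardinal.eq.1 (by rw [mk_finset_of_infinite, mk_ord_toType, h₄])
  refine ⟨fun α => ⋂ B ∈ e α, B.1, fun α => ?_, fun α β => ⟨e.symm (e α ∪ e β), ?_⟩, ?_⟩
  · rcases (e α).eq_empty_or_nonempty with h | h
    · simpa [h] using infinite_univ
    · refine (h₂ ((e α).map (Function.Embedding.subtype _)) ?_ (by simpa)).mono ?_
      · rintro _ hx
        obtain ⟨B, -, rfl⟩ := Finset.mem_map.1 hx
        exact B.2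
      · intro x hx
        simpa using hx
  · intro x hx
    simp only [Equiv.apply_symm_apply, Finset.mem_union, mem_iInter, mem_inter_iff] at hx ⊢
    exact ⟨fun B hB => hx B (.inl hB), fun B hB => hx B (.inr hB)⟩
  · rintro ⟨X, hX, hXA⟩
    refine h₃ ⟨X, hX, fun B hB => (hXA (e.symm {⟨B, hB⟩})).trans (almostSubset_of_subset ?_)⟩
    simp

theorem exists_descending_sequence {ι : Type} [LinearOrder ι] [WellFoundedLT ι]
    (hι : #ι < towerNum) {A : ι → Set ℕ} (inf : ∀ α, (A α).Infinite)
    (dir : ∀ α β, ∃ γ, A γ ⊆ A α ∩ A β)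
    (noPseudo : ¬ ∃ X : Set ℕ, X.Infinite ∧ ∀ α, AlmostSubset X (A α)) :
    ∃ (β : ι) (K : Set ι) (B : ι → Set ℕ), K ⊆ Iio β ∧ ℵ₀ ≤ #K ∧ (∀ i : K, #(Iio i) < #K) ∧
      (∀ i ∈ K, ∀ j ∈ K, i < j → AlmostSubset (B j) (B i)) ∧
      (∀ i ∈ K, ∀ α, (B i ∩ A α).Infinite) ∧
      ¬ ∃ X, (∀ i ∈ K, AlmostSubset X (B i)) ∧ ∀ α, (X ∩ A α).Infinite := by
  let P : ι → (ι → Set ℕ) → Set ℕ → Prop := fun β B X =>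
    (∀ α, (X ∩ A α).Infinite) ∧ (∀ j < β, AlmostSubset X (B j)) ∧ X ⊆ A β
  obtain ⟨β, B, hB, hno⟩ : ∃ β B, (∀ j < β, P j B (B j)) ∧ ¬ ∃ X, P β B X := by
    by_contra! hex
    obtain ⟨B, hB⟩ := exists_history P
      (fun i f f' X hf ⟨h₁, h₂, h₃⟩ => ⟨h₁, fun j hj => hf j hj ▸ h₂ j hj, h₃⟩) hex
    obtain ⟨X, hX, hXB⟩ := exists_pseudointersection_of_chain hι B
      (fun α => ((hB α).1 α).mono inter_subset_left)
      (fun i j => by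
        rcases lt_trichotomy i j with h | rfl | h
        · exact .inr ((hB j).2.1 i h)
        · exact .inl (almostSubset_of_subset subset_rfl)
        · exact .inl ((hB i).2.1 j h))
    exact noPseudo ⟨X, hX, fun α => (hXB α).trans (almostSubset_of_subset (hB α).2.2)⟩
  have hno' : ¬ ∃ X, (∀ j < β, AlmostSubset X (B j)) ∧ ∀ α, (X ∩ A α).Infinite := by
    rintro ⟨X, hX, hXA⟩
    refine hno ⟨X ∩ A β, fun α => ?_,
      fun j hj => (almostSubset_of_subset inter_subset_left).trans (hX j hj), inter_subset_right⟩
    obtain ⟨γ, hγ⟩ := dir β α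
    rw [inter_assoc]
    exact (hXA γ).mono (inter_subset_inter_right _ hγ)
  obtain ⟨S, hS, hStype⟩ := Ordinal.exists_ord_cof_eq (Iio β)
  have hBmono : ∀ i j, i ≤ j → j < β → AlmostSubset (B j) (B i) := fun i j hij hj => by
    rcases hij.eq_or_lt with rfl | hij
    · exact almostSubset_of_subset subset_rfl
    · exact (hB j hj).2.1 i hij
  have hcof : ∀ i < β, ∃ j ∈ Subtype.val '' S, i ≤ j := fun i hi => by
    obtain ⟨j, hj, hij⟩ := hS ⟨i, hi⟩
    exact ⟨j, mem_image_of_mem _ hj, hij⟩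
  have hne : Nonempty (Iio β) := by
    by_contra hemp
    refine hno' ⟨univ, fun j hj => (hemp ⟨j, hj⟩).elim, fun α => by simpa using inf α⟩
  have : NoMaxOrder (Iio β) := ⟨fun j => by
    by_contra! hmax
    exact hno' ⟨B j, fun i hi => hBmono i j (hmax ⟨i, hi⟩) j.2, (hB j j.2).1⟩⟩
  have hcard : #S = Order.cof (Iio β) := by
    simpa using congrArg Ordinal.card hStype
  let eS : S ≃o (Subtype.val '' S : Set ι) :=
    { Equiv.Set.image _ S Subtype.val_injective with map_rel_iff' := Iff.rfl }
  have hcard' : #(Subtype.val '' S : Set ι) = #S := mk_image_eq Subtype.val_injective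
  refine ⟨β, Subtype.val '' S, B, by rintro _ ⟨i, -, rfl⟩; exact i.2, ?_, fun i => ?_, ?_, ?_, ?_⟩
  · rw [hcard', hcard]
    exact Order.aleph0_le_cof
  · refine mk_Iio_lt i ?_
    rw [hcard', hcard, ← hStype]
    exact Ordinal.type_eq.2 ⟨eS.toRelIsoLT⟩
  · rintro i - _ ⟨j, -, rfl⟩ hij
    exact hBmono i j hij.le j.2
  · rintro _ ⟨j, -, rfl⟩
    exact (hB j j.2).1
  · rintro ⟨X, hX, hXA⟩
    refine hno' ⟨X, fun i hi => ?_, hXA⟩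
    obtain ⟨_, ⟨j, hj, rfl⟩, hij⟩ := hcof i hi
    exact (hX j ⟨j, hj, rfl⟩).trans (hBmono i j hij j.2)

/-- The functions `f i`, decreasing modulo finite along `N`, lie above all the functions `r α`,
and no function on an infinite subset of `N` separates the two families. -/
structure IsGap {ι K : Type} [LinearOrder K] (N : Set ℕ) (r : ι → ℕ → ℕ) (f : K → ℕ → ℕ)
    (G : ℕ → ℕ) : Prop where
  infinite : N.Infinite
  anti : ∀ i j, i < j → ∀ᶠ n in tail N, f j n ≤ f i n
  lt : ∀ α i, ∀ᶠ n in tail N, r α n < f i n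
  le : ∀ i n, f i n ≤ G n
  no_separation : ∀ M : Set ℕ, M.Infinite → AlmostSubset M N → ∀ h : ℕ → ℕ,
    (∀ i, ∀ᶠ n in tail M, h n < f i n) → (∀ α, ∀ᶠ n in tail M, r α n ≤ h n) → False

theorem exists_isGap {ι K : Type} [LinearOrder K] [Nonempty K] (hK : #K < pseudoNum)
    (hKι : #(K × ι) < towerNum) {A : ι → Set ℕ} {B : K → Set ℕ}
    (anti : ∀ i j, i < j → AlmostSubset (B j) (B i)) (inf : ∀ i α, (B i ∩ A α).Infinite)
    (no : ¬ ∃ X, (∀ i, AlmostSubset X (B i)) ∧ ∀ α, (X ∩ A α).Infinite) :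
    ∃ (N : Set ℕ) (r : ι → ℕ → ℕ) (f : K → ℕ → ℕ) (G : ℕ → ℕ), IsGap N r f G := by
  classical
  choose x hx using fun (p : K × ι) n => (inf p.1 p.2).exists_gt n
  obtain ⟨H, hH⟩ := exists_dominating hKι fun p n => x p n + 1
  let I : ℕ → Finset ℕ := fun n => Finset.Ico n (H n)
  have anti' : ∀ i j, i < j → ∀ᶠ n in atTop, ∀ y ∈ I n, y ∈ B j → y ∈ B i := fun i j hij => by
    obtain ⟨k, hk⟩ := eventually_atTop.1 (eventually_tail.1 (almostSubset_iff.1 (anti i j hij)))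
    filter_upwards [eventually_ge_atTop k] with n hn y hy
    exact hk y (hn.trans (Finset.mem_Ico.1 hy).1)
  obtain ⟨N, hN, ρ, hρ⟩ := exists_selector (V := ℕ →₀ ℕ) hK
    (fun i n ρ => ∀ y ∈ I n, ∀ z ∈ I n, y ∈ B i → z ∉ B i → ρ y < ρ z) fun s => by
      refine Eventually.frequently ?_
      have : ∀ᶠ n in atTop, ∀ i ∈ s, ∀ j ∈ s, i < j → ∀ y ∈ I n, y ∈ B j → y ∈ B i := by
        simp only [Finset.eventually_all, eventually_imp_distrib_left]
        exact fun i _ j _ => anti' i j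
      filter_upwards [this] with n hn
      refine ⟨Finsupp.indicator (I n) fun y _ => (s.filter fun j => y ∉ B j).card, ?_⟩
      intro i hi y hy z hz hyi hzi
      rw [Finsupp.indicator_of_mem hy, Finsupp.indicator_of_mem hz]
      refine Finset.card_lt_card
        ((Finset.ssubset_iff_of_subset ?_).2 ⟨i, by simp [*], by simp [*]⟩)
      intro j hj
      simp only [Finset.mem_filter] at hj ⊢
      refine ⟨hj.1, fun hzj => ?_⟩
      rcases lt_trichotomy i j with h | rfl | h
      · exact hzi (hn i hi j hj.1 h z hz hzj)
      · exact hzi hzj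
      · exact hj.2 (hn j hj.1 i hi h y hy hyi)
  let f : K → ℕ → ℕ := fun i n => ((I n).filter (· ∈ B i)).sup fun y => ρ n y + 1
  have hf : ∀ i n, ∀ y ∈ I n, y ∈ B i → ρ n y < f i n := fun i n y hy hyi =>
    Nat.lt_of_succ_le (Finset.le_sup (f := fun y => ρ n y + 1) (by simp [hy, hyi]))
  have hf' : ∀ i, ∀ᶠ n in tail N, ∀ y ∈ I n, ρ n y < f i n → y ∈ B i := fun i => by
    filter_upwards [hρ i] with n hn y hy hlt
    by_contra hyi
    refine hlt.not_ge (Finset.sup_le fun z hz => ?_)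
    simp only [Finset.mem_filter] at hz
    exact hn z hz.1 y hy hz.2 hyi
  have hmeet : ∀ i α, ∀ᶠ n in atTop, ∃ y ∈ I n, y ∈ B i ∧ y ∈ A α := fun i α => by
    filter_upwards [hH (i, α)] with n hn
    obtain ⟨h₁, h₂⟩ := hx (i, α) n
    exact ⟨x (i, α) n, Finset.mem_Ico.2 ⟨h₂.le, hn⟩, h₁.1, h₁.2⟩
  refine ⟨N, fun α n => sInf (ρ n '' {y | y ∈ I n ∧ y ∈ A α}), f,
    fun n => (I n).sup fun y => ρ n y + 1, hN, fun i j hij => ?_, fun α i => ?_,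
    fun i n => Finset.sup_mono (Finset.filter_subset _ _), fun M hM hMN h hhf hrh => ?_⟩
  · filter_upwards [tail_le_atTop N (anti' i j hij)] with n hn
    refine Finset.sup_mono fun y hy => ?_
    simp only [Finset.mem_filter] at hy ⊢
    exact ⟨hy.1, hn y hy.1 hy.2⟩
  · filter_upwards [tail_le_atTop N (hmeet i α)] with n hn
    obtain ⟨y, hy, hyB, hyA⟩ := hn
    have hmem : y ∈ {y | y ∈ I n ∧ y ∈ A α} := ⟨hy, hyA⟩
    exact (Nat.sInf_le (mem_image_of_mem (ρ n) hmem)).trans_lt (hf i n y hy hyB)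
  · refine no ⟨{y | ∃ n ∈ M, y ∈ I n ∧ ρ n y ≤ h n}, fun i => ?_, fun α => ?_⟩
    · obtain ⟨k, hk⟩ := eventually_atTop.1
        (eventually_tail.1 ((hhf i).and ((hf' i).filter_mono hMN.tail_le)))
      refine ((Finset.range k).biUnion I).finite_toSet.subset ?_
      rintro y ⟨⟨n, hnM, hyn, hle⟩, hyi⟩
      simp only [Finset.coe_biUnion, Finset.coe_range]
      refine mem_biUnion (show n < k from ?_) hyn
      by_contra! hkn
      obtain ⟨h₁, h₂⟩ := hk n hkn hnM
      exact hyi (h₂ y hyn (hle.trans_lt h₁))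
    · obtain ⟨i⟩ := ‹Nonempty K›
      refine Set.infinite_of_not_bddAbove fun ⟨b, hb⟩ => ?_
      have := hM.neBot_tail
      obtain ⟨n, hnM, hr, ⟨y, hy, -, hyA⟩, hbn⟩ := ((eventually_tail_mem M).and
        ((hrh α).and (tail_le_atTop M ((hmeet i α).and (eventually_gt_atTop b))))).exists
      obtain ⟨z, ⟨hz, hzA⟩, hzr⟩ := Nat.sInf_mem (s := ρ n '' {y | y ∈ I n ∧ y ∈ A α})
        ⟨_, y, ⟨hy, hyA⟩, rfl⟩
      have hzb : z ≤ b := hb ⟨⟨n, hnM, hz, hzr.trans_le hr⟩, hzA⟩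
      exact hbn.not_ge ((Finset.mem_Ico.1 hz).1.trans hzb)

/-! ### Finite approximations -/

/-- A finite approximation: a finite set of triples `(x, y, v)`, saying that the pair `x < y`
has value `v`, and a finite set of pairs `(m, x)`, saying that `x` is alive at level `m`. -/
abbrev Approx := Finset (ℕ × ℕ × ℕ) × Finset (ℕ × ℕ)

/-- Two points alive at the same level have a value above that level. -/
structure Approx.Valid (c : Approx) : Prop where
  le : ∀ m x, (m, x) ∈ c.2 → x ≤ m
  lt : ∀ x y v m, x < y → (x, y, v) ∈ c.1 → (m, x) ∈ c.2 → (m, y) ∈ c.2 → m < v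

/-- All entries are at most `b`. -/
structure Approx.Bounded (b : ℕ) (c : Approx) : Prop where
  fst : ∀ x y v, (x, y, v) ∈ c.1 → x ≤ b ∧ y ≤ b ∧ v ≤ b
  snd : ∀ m x, (m, x) ∈ c.2 → m ≤ b ∧ x ≤ b

/-- The approximations agree on pairs with top below `k` and on levels below `k`. -/
structure Approx.AgreeBelow (k : ℕ) (c d : Approx) : Prop where
  fst : ∀ x y v, y < k → ((x, y, v) ∈ c.1 ↔ (x, y, v) ∈ d.1)
  snd : ∀ m x, m < k → ((m, x) ∈ c.2 ↔ (m, x) ∈ d.2)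

theorem Approx.AgreeBelow.refl (k : ℕ) (c : Approx) : AgreeBelow k c c :=
  ⟨fun _ _ _ _ => Iff.rfl, fun _ _ _ => Iff.rfl⟩

theorem Approx.AgreeBelow.trans {k l : ℕ} {c d e : Approx} (h : AgreeBelow k c d)
    (h' : AgreeBelow l d e) (hkl : k ≤ l) : AgreeBelow k c e :=
  ⟨fun x y v hy => (h.fst x y v hy).trans (h'.fst x y v (hy.trans_le hkl)),
    fun m x hm => (h.snd m x hm).trans (h'.snd m x (hm.trans_le hkl))⟩

theorem Approx.finite_bounded (b : ℕ) : {c | Bounded b c}.Finite := by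
  let R := Finset.range (b + 1)
  refine ((R ×ˢ R ×ˢ R).powerset ×ˢ (R ×ˢ R).powerset).finite_toSet.subset fun c hc => ?_
  simp only [Finset.coe_product, mem_prod, Finset.mem_coe, Finset.mem_powerset]
  refine ⟨fun ⟨x, y, v⟩ h => ?_, fun ⟨m, x⟩ h => ?_⟩
  · simpa [R, Nat.lt_succ_iff] using hc.fst x y v h
  · simpa [R, Nat.lt_succ_iff] using hc.snd m x h

/-- A valid bounded approximation with a distinguished point, alive at its own level. -/
structure IsNode (b : ℕ) (p : ℕ × Approx) : Prop where
  valid : p.2.Valid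
  bounded : p.2.Bounded b
  mem : (p.1, p.1) ∈ p.2.2

/-- The node `q` extends `p` by a point above that of `p`, the point of `p` stays alive, and the
value of the two points is `w`. -/
structure Linked (w : ℕ) (p q : ℕ × Approx) : Prop where
  lt : p.1 < q.1
  agree : Approx.AgreeBelow (p.1 + 1) p.2 q.2
  alive : ∀ m, p.1 ≤ m → m ≤ q.1 → (m, p.1) ∈ q.2.2
  value : ∀ v, (p.1, q.1, v) ∈ q.2.1 ↔ v = w

theorem isNode_singleton {b y : ℕ} (h : y ≤ b) : IsNode b (y, ∅, {(y, y)}) where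
  valid := ⟨by simp, by simp⟩
  bounded := ⟨by simp, by simp [h]⟩
  mem := by simp

theorem exists_linked {ι : Type} [LinearOrder ι] {b y : ℕ} {s : Finset ι} {γ : ι}
    {p : ι → ℕ × Approx} {W : ι → ι → ℕ} {w : ι → ℕ} (hγ : γ ∈ s) (hmax : ∀ α ∈ s, α ≤ γ)
    (node : ∀ α ∈ s, IsNode b (p α))
    (link : ∀ α ∈ s, ∀ α' ∈ s, α < α' → Linked (W α α') (p α) (p α'))
    (hy : (p γ).1 < y) (hyb : y ≤ b) (hw : ∀ α ∈ s, y < w α) (hwb : ∀ α ∈ s, w α ≤ b)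
    (hW : ∀ α ∈ s, ∀ α' ∈ s, α < α' → y < W α α') :
    ∃ c : Approx, IsNode b (y, c) ∧ ∀ α ∈ s, Linked (w α) (p α) (y, c) := by
  classical
  set k := (p γ).1 + 1
  have hle : ∀ α ∈ s, (p α).1 < k ∧ Approx.AgreeBelow ((p α).1 + 1) (p α).2 (p γ).2 ∧
      ∀ m, (p α).1 ≤ m → m < k → (m, (p α).1) ∈ (p γ).2.2 := fun α hα => by
    rcases (hmax α hα).eq_or_lt with rfl | hlt
    · refine ⟨Nat.lt_succ_self _, .refl _ _, fun m h₁ h₂ => ?_⟩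
      obtain rfl : m = (p α).1 := by omega
      exact (node α hα).mem
    · have hl := link α hα γ hγ hlt
      exact ⟨hl.lt.trans (Nat.lt_succ_self _), hl.agree,
        fun m h₁ h₂ => hl.alive m h₁ (Nat.le_of_lt_succ h₂)⟩
  have hinj : ∀ α ∈ s, ∀ α' ∈ s, (p α).1 = (p α').1 → α = α' := fun α hα α' hα' h => by
    rcases lt_trichotomy α α' with hlt | rfl | hlt
    · exact absurd h (link α hα α' hα' hlt).lt.ne
    · rfl
    · exact absurd h (link α' hα' α hα hlt).lt.ne'
  have hlt : ∀ α ∈ s, ∀ α' ∈ s, (p α).1 < (p α').1 → α < α' := fun α hα α' hα' h => by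
    rcases lt_trichotomy α α' with hlt | rfl | hlt
    · exact hlt
    · exact absurd h (lt_irrefl _)
    · exact absurd h (link α' hα' α hα hlt).lt.not_gt
  have hval := (node γ hγ).valid
  have hbdd := (node γ hγ).bounded
  let c : Approx :=
    ((p γ).2.1.filter (·.2.1 < k) ∪ s.image fun α => ((p α).1, y, w α),
      (p γ).2.2.filter (·.1 < k) ∪ (Finset.Icc k y ×ˢ s.image fun α => (p α).1) ∪ {(y, y)})
  have hc₁ : ∀ x z v, (x, z, v) ∈ c.1 ↔ ((x, z, v) ∈ (p γ).2.1 ∧ z < k) ∨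
      ∃ α ∈ s, x = (p α).1 ∧ z = y ∧ v = w α := fun x z v => by
    simp only [c, Finset.mem_union, Finset.mem_filter, Finset.mem_image, Prod.mk.injEq]
    grind
  have hc₂ : ∀ m x, (m, x) ∈ c.2 ↔ ((m, x) ∈ (p γ).2.2 ∧ m < k) ∨
      (k ≤ m ∧ m ≤ y ∧ ∃ α ∈ s, x = (p α).1) ∨ (m = y ∧ x = y) := fun m x => by
    simp only [c, Finset.mem_union, Finset.mem_filter, Finset.mem_image, Prod.mk.injEq,
      Finset.mem_product, Finset.mem_Icc, Finset.mem_singleton]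
    grind
  have hky : k ≤ y := hy
  refine ⟨c, ⟨⟨fun m x h => ?_, fun x z v m hxz h₁ h₂ h₃ => ?_⟩,
    ⟨fun x z v h => ?_, fun m x h => ?_⟩,
    (hc₂ _ _).2 (.inr (.inr ⟨rfl, rfl⟩))⟩, fun α hα => ⟨?_, ?_, fun m h₁ h₂ => ?_, fun v => ?_⟩⟩
  · rcases (hc₂ m x).1 h with ⟨h', -⟩ | ⟨h', -, α, hα, rfl⟩ | ⟨rfl, rfl⟩
    · exact hval.le m x h'
    · exact (hle α hα).1.le.trans h'
    · exact le_rfl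
  · rcases (hc₁ x z v).1 h₁ with ⟨h, hz⟩ | ⟨α, hα, rfl, rfl, rfl⟩
    · rcases (hc₂ m x).1 h₂ with ⟨h₂, hm⟩ | ⟨hkm, hmy, α, hα, rfl⟩ | ⟨rfl, rfl⟩
      · rcases (hc₂ m z).1 h₃ with ⟨h₃, -⟩ | ⟨h₃, -⟩ | ⟨rfl, rfl⟩
        · exact hval.lt x z v m hxz h h₂ h₃
        all_goals omega
      · rcases (hc₂ m z).1 h₃ with ⟨-, hm⟩ | ⟨-, -, α', hα', rfl⟩ | ⟨rfl, rfl⟩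
        · omega
        · have hαα' := hlt α hα α' hα' hxz
          have hl := link α hα α' hα' hαα'
          have hv := (hl.value v).1 (((hle α' hα').2.1.fst _ _ _ (Nat.lt_succ_self _)).2 h)
          exact hmy.trans_lt (hv ▸ hW α hα α' hα' hαα')
        · omega
      · omega
    · rcases (hc₂ m z).1 h₃ with ⟨h₃, hm⟩ | ⟨-, -, α', hα', rfl⟩ | ⟨rfl, -⟩
      · exact absurd (hval.le _ _ h₃) (by omega)
      · exact absurd (hle α' hα').1 (by omega)
      · exact hw α hα
  · rcases (hc₁ x z v).1 h with ⟨h, -⟩ | ⟨α, hα, rfl, rfl, rfl⟩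
    · exact hbdd.fst x z v h
    · exact ⟨(hle α hα).1.le.trans (hky.trans hyb), hyb, hwb α hα⟩
  · rcases (hc₂ m x).1 h with ⟨h, -⟩ | ⟨-, hmy, α, hα, rfl⟩ | ⟨rfl, rfl⟩
    · exact hbdd.snd m x h
    · exact ⟨hmy.trans hyb, (hle α hα).1.le.trans (hky.trans hyb)⟩
    · exact ⟨hyb, hyb⟩
  · exact (hle α hα).1.trans_le hky
  · refine (hle α hα).2.1.trans (l := k) ⟨fun x z v hz => ?_, fun m x hm => ?_⟩ (hle α hα).1
    · rw [hc₁]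
      refine ⟨fun h => .inl ⟨h, hz⟩, ?_⟩
      rintro (⟨h, -⟩ | ⟨-, -, -, rfl, -⟩)
      · exact h
      · omega
    · rw [hc₂]
      refine ⟨fun h => .inl ⟨h, hm⟩, ?_⟩
      rintro (⟨h, -⟩ | ⟨h, -⟩ | ⟨rfl, -⟩)
      · exact h
      all_goals omega
  · refine (hc₂ _ _).2 ?_
    rcases lt_or_ge m k with hm | hm
    · exact .inl ⟨(hle α hα).2.2 m h₁ hm, hm⟩
    · exact .inr (.inl ⟨hm, h₂, α, hα, rfl⟩)
  · rw [hc₁]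
    constructor
    · rintro (⟨-, h⟩ | ⟨α', hα', h, -, rfl⟩)
      · exact absurd h hky.not_gt
      · rw [hinj α hα α' hα' h]
    · rintro rfl
      exact .inr ⟨α, hα, rfl, rfl, rfl⟩

/-! ### Extending a gap along a well-order -/

theorem infinite_of_frequently_tail {M : Set ℕ} {P : ℕ → Prop} (h : ∃ᶠ n in tail M, P n) :
    {n ∈ M | P n}.Infinite := by
  rw [tail, frequently_inf_principal] at h
  exact Nat.frequently_atTop_iff_infinite.1 h

namespace IsGap

variable {ι K : Type} [LinearOrder K] {N M : Set ℕ} {r : ι → ℕ → ℕ} {f : K → ℕ → ℕ} {G : ℕ → ℕ}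

theorem succ_lt (hg : IsGap N r f G) (hMN : AlmostSubset M N) {h : ℕ → ℕ}
    (hh : ∀ i, ∀ᶠ n in tail M, h n < f i n) (i : K) : ∀ᶠ n in tail M, h n + 1 < f i n := by
  by_contra hi
  have hsub : AlmostSubset {n ∈ M | ¬ h n + 1 < f i n} M := almostSubset_of_subset (sep_subset _ _)
  refine hg.no_separation _ (infinite_of_frequently_tail (not_eventually.1 hi)) (hsub.trans hMN) h
    (fun j => (hh j).filter_mono hsub.tail_le) fun α => ?_
  filter_upwards [(hsub.trans hMN).tail_le (hg.lt α i), eventually_tail_mem _] with n h₁ h₂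
  have := h₂.2
  omega

theorem exists_le [Nonempty K] (hg : IsGap N r f G) (hK : #K < towerNum)
    (hMN : AlmostSubset M N) {d : ℕ → ℕ} (hd : ∀ α, ∀ᶠ n in tail M, r α n ≤ d n) :
    ∃ i, ∀ᶠ n in tail M, f i n ≤ d n := by
  by_contra! hno
  let C : K → Set ℕ := fun i => {n ∈ M | d n < f i n}
  have hCM : ∀ i, AlmostSubset (C i) M := fun i => almostSubset_of_subset (sep_subset _ _)
  have hC : ∀ i j, i < j → AlmostSubset (C j) (C i) := fun i j hij => by
    refine almostSubset_iff.2 ?_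
    filter_upwards [((hCM j).trans hMN).tail_le (hg.anti i j hij), eventually_tail_mem _]
      with n h₁ h₂
    exact ⟨h₂.1, h₂.2.trans_le h₁⟩
  obtain ⟨D, hD, hDC⟩ := exists_pseudointersection_of_chain hK C
    (fun i => infinite_of_frequently_tail (by simpa using hno i)) fun i j => by
      rcases lt_trichotomy i j with h | rfl | h
      · exact .inr (hC _ _ h)
      · exact .inl (almostSubset_of_subset subset_rfl)
      · exact .inl (hC _ _ h)
  have hDM : AlmostSubset D M := (hDC (Classical.arbitrary K)).trans (hCM _)
  refine hg.no_separation D hD (hDM.trans hMN) d (fun i => ?_)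
    fun α => (hd α).filter_mono hDM.tail_le
  filter_upwards [almostSubset_iff.1 (hDC i)] with n hn using hn.2

end IsGap

/-- The requirements at `β` on a set `S.1` and a sequence of nodes `S.2` in the recursion. -/
structure IsStage {ι K : Type} [LinearOrder ι] [LinearOrder K] (N : Set ℕ) (r : ι → ℕ → ℕ)
    (f : K → ℕ → ℕ) (G : ℕ → ℕ) (g : ι → ι → K) (β : ι) (F : ι → Set ℕ × (ℕ → ℕ × Approx))
    (S : Set ℕ × (ℕ → ℕ × Approx)) : Prop where
  infinite : S.1.Infinite
  sub : AlmostSubset S.1 N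
  node : ∀ᶠ n in tail S.1, IsNode (G n) (S.2 n)
  le : ∀ᶠ n in tail S.1, r β n ≤ (S.2 n).1
  lt : ∀ i, ∀ᶠ n in tail S.1, (S.2 n).1 < f i n
  sub_prev : ∀ γ < β, AlmostSubset S.1 (F γ).1
  linked : ∀ γ < β, ∀ᶠ n in tail S.1, Linked (f (g γ β) n) ((F γ).2 n) (S.2 n)

theorem IsGap.exists_stages {ι K : Type} [LinearOrder ι] [WellFoundedLT ι] [LinearOrder K]
    [Nonempty K] {N : Set ℕ} {r : ι → ℕ → ℕ} {f : K → ℕ → ℕ} {G : ℕ → ℕ} (hg : IsGap N r f G)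
    (hK : #K < pseudoNum) (hι : ∀ β : ι, #(Iio β) < pseudoNum) (g : ι → ι → K) :
    ∃ F : ι → Set ℕ × (ℕ → ℕ × Approx), ∀ β, IsStage N r f G g β F (F β) := by
  classical
  refine exists_history (IsStage N r f G g) (fun β F F' S hF h => ?_) fun β F hF => ?_
  · exact ⟨h.infinite, h.sub, h.node, h.le, h.lt, fun γ hγ => hF γ hγ ▸ h.sub_prev γ hγ,
      fun γ hγ => hF γ hγ ▸ h.linked γ hγ⟩
  let i₀ : K := Classical.arbitrary K
  let Q : Iio β ⊕ K → ℕ → ℕ × Approx → Prop := Sum.elim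
    (fun γ n q => n ∈ (F γ).1 ∧ Linked (f (g γ β) n) ((F γ).2 n) q)
    fun i n q => n ∈ N ∧ IsNode (G n) q ∧ r β n ≤ q.1 ∧ q.1 < f i n
  have hcard : #(Iio β ⊕ K) < pseudoNum := by
    rw [mk_sum, lift_id, lift_id]
    exact add_lt_of_lt aleph0_lt_pseudoNum.le (hι β) hK
  obtain ⟨T, hT, q, hq⟩ := exists_selector hcard Q fun s => by
    have hcase : ∃ᶠ n in atTop, n ∈ N ∧ ∃ q, IsNode (G n) q ∧ r β n ≤ q.1 ∧
        (∀ i ∈ s.toRight, q.1 < f i n) ∧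
        ∀ γ ∈ s.toLeft, n ∈ (F γ).1 ∧ Linked (f (g γ β) n) ((F γ).2 n) q := by
      rcases s.toLeft.eq_empty_or_nonempty with hs | hs
      · refine hg.infinite.frequently_of_tail ?_
        have : ∀ᶠ n in tail N, ∀ i ∈ s.toRight, r β n < f i n := by
          simp only [Finset.eventually_all]
          exact fun i _ => hg.lt β i
        filter_upwards [this, hg.lt β i₀, eventually_tail_mem N] with n h₁ h₂ h₃
        exact ⟨h₃, (r β n, ∅, {(r β n, r β n)}), isNode_singleton (h₂.le.trans (hg.le i₀ n)),
          le_rfl, h₁, by simp [hs]⟩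
      · obtain ⟨γ, hγ, hmax⟩ := s.toLeft.exists_max_image id hs
        have hFγ := hF γ γ.2
        have hsub : ∀ α ∈ s.toLeft, AlmostSubset (F γ).1 (F α).1 := fun α hα => by
          rcases (hmax α hα).eq_or_lt with h | h
          · exact almostSubset_of_subset (by rw [show α = γ from h])
          · exact hFγ.sub_prev α h
        refine hFγ.infinite.frequently_of_tail ?_
        have hy : ∀ i, ∀ᶠ n in tail (F γ).1, max (((F γ).2 n).1 + 1) (r β n) < f i n := fun i => by
          filter_upwards [hg.succ_lt hFγ.sub hFγ.lt i, hFγ.sub.tail_le (hg.lt β i)] with n h₁ h₂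
          exact max_lt h₁ h₂
        have h₁ : ∀ᶠ n in tail (F γ).1, ∀ i ∈ s.toRight,
            max (((F γ).2 n).1 + 1) (r β n) < f i n := by
          simp only [Finset.eventually_all]
          exact fun i _ => hy i
        have h₂ : ∀ᶠ n in tail (F γ).1, ∀ α ∈ s.toLeft, n ∈ (F α).1 ∧ IsNode (G n) ((F α).2 n) ∧
            max (((F γ).2 n).1 + 1) (r β n) < f (g α β) n := by
          simp only [Finset.eventually_all]
          exact fun α hα => (almostSubset_iff.1 (hsub α hα)).and
            (((hF α α.2).node.filter_mono (hsub α hα).tail_le).and (hy _))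
        have h₃ : ∀ᶠ n in tail (F γ).1, ∀ α ∈ s.toLeft, ∀ α' ∈ s.toLeft, α < α' →
            Linked (f (g α α') n) ((F α).2 n) ((F α').2 n) ∧
            max (((F γ).2 n).1 + 1) (r β n) < f (g α α') n := by
          simp only [Finset.eventually_all, eventually_imp_distrib_left]
          exact fun α _ α' hα' h =>
            (((hF α' α'.2).linked α h).filter_mono (hsub α' hα').tail_le).and (hy _)
        filter_upwards [h₁, h₂, h₃, hy i₀, hFγ.sub.tail_le (eventually_tail_mem N)]
          with n h₁ h₂ h₃ h₄ h₅
        obtain ⟨c, hc, hcl⟩ := exists_linked (p := fun α : Iio β => (F α).2 n)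
          (W := fun α α' => f (g α α') n) (w := fun α => f (g α β) n) hγ hmax
          (fun α hα => (h₂ α hα).2.1) (fun α hα α' hα' h => (h₃ α hα α' hα' h).1)
          (Nat.lt_of_succ_le (le_max_left _ (r β n))) (h₄.le.trans (hg.le i₀ n))
          (fun α hα => (h₂ α hα).2.2) (fun α _ => hg.le _ n)
          fun α hα α' hα' h => (h₃ α hα α' hα' h).2
        exact ⟨h₅, _, hc, le_max_right _ _, h₁, fun α hα => ⟨(h₂ α hα).1, hcl α hα⟩⟩
    refine hcase.mono ?_
    rintro n ⟨hn, q, h₁, h₂, h₃, h₄⟩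
    refine ⟨q, ?_⟩
    rintro (γ | i) hi
    · exact h₄ γ (by simpa using hi)
    · exact ⟨hn, h₁, h₂, h₃ i (by simpa using hi)⟩
  have hqK := fun i => hq (.inr i)
  have hqι := fun γ hγ => hq (.inl ⟨γ, hγ⟩)
  exact ⟨(T, q), hT, almostSubset_iff.2 ((hqK i₀).mono fun n h => h.1),
    (hqK i₀).mono fun n h => h.2.1, (hqK i₀).mono fun n h => h.2.2.1,
    fun i => (hqK i).mono fun n h => h.2.2.2,
    fun γ hγ => almostSubset_iff.2 ((hqι γ hγ).mono fun n h => h.1),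
    fun γ hγ => (hqι γ hγ).mono fun n h => h.2⟩

theorem exists_approx {ι K : Type} [LinearOrder ι] [Nonempty ι] [LinearOrder K]
    {N : Set ℕ} {r : ι → ℕ → ℕ} {f : K → ℕ → ℕ} {G : ℕ → ℕ} {g : ι → ι → K}
    {F : ι → Set ℕ × (ℕ → ℕ × Approx)} (hF : ∀ β, IsStage N r f G g β F (F β))
    (hι : #ι < towerNum) :
    ∃ (M : Set ℕ) (c : ℕ → Approx), M.Infinite ∧ ∀ β, AlmostSubset M (F β).1 ∧
      ∀ᶠ n in tail M, (c n).Valid ∧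
        Approx.AgreeBelow (((F β).2 n).1 + 1) ((F β).2 n).2 (c n) := by
  obtain ⟨M, hM, c, hc⟩ := exists_selector_of_chain (V := Approx) hι
    (fun β n c => n ∈ (F β).1 ∧ c.Bounded (G n) ∧ c.Valid ∧
      Approx.AgreeBelow (((F β).2 n).1 + 1) ((F β).2 n).2 c)
    (fun β n => (Approx.finite_bounded (G n)).subset fun c h => h.2.1)
    (fun β => (hF β).infinite.frequently_of_tail <|
      ((eventually_tail_mem _).and (hF β).node).mono fun n h =>
        ⟨_, h.1, h.2.bounded, h.2.valid, .refl _ _⟩)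
    (fun β α hα => by
      filter_upwards [eventually_tail.1 (almostSubset_iff.1 ((hF β).sub_prev α hα)),
        eventually_tail.1 ((hF β).linked α hα)] with n h₁ h₂ c h
      have h₂ := h₂ h.1
      exact ⟨h₁ h.1, h.2.1, h.2.2.1, h₂.agree.trans h.2.2.2 (Nat.succ_le_succ h₂.lt.le)⟩)
  exact ⟨M, c, hM, fun β => ⟨almostSubset_iff.2 ((hc β).mono fun n h => h.1),
    (hc β).mono fun n h => h.2.2⟩⟩

theorem IsGap.not_coloring {ι K : Type} [LinearOrder ι] [WellFoundedLT ι] [Nonempty ι]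
    [LinearOrder K] [Nonempty K] {N : Set ℕ} {r : ι → ℕ → ℕ} {f : K → ℕ → ℕ} {G : ℕ → ℕ}
    (hg : IsGap N r f G) (hK : #K < pseudoNum) (hι : ∀ β : ι, #(Iio β) < pseudoNum)
    (hιt : #ι < towerNum) (g : ι → ι → K) :
    ∃ φ : ι → K, ∀ α β, α < β → φ α = φ β → ¬ φ α ≤ g α β := by
  classical
  obtain ⟨F, hF⟩ := hg.exists_stages hK hι g
  obtain ⟨M, c, hM, hMc⟩ := exists_approx hF hιt
  have hMF := fun β => (hMc β).1
  have hMN : AlmostSubset M N := (hMF (Classical.arbitrary ι)).trans (hF _).sub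
  have hnode : ∀ α, ∀ᶠ n in tail M, IsNode (G n) ((F α).2 n) := fun α =>
    (hF α).node.filter_mono (hMF α).tail_le
  have hlink : ∀ α β, α < β →
      ∀ᶠ n in tail M, Linked (f (g α β) n) ((F α).2 n) ((F β).2 n) := fun α β h =>
    ((hF β).linked α h).filter_mono (hMF β).tail_le
  let Alive : ι → ℕ → ℕ → Prop := fun α n l =>
    ∀ m, ((F α).2 n).1 ≤ m → m ≤ l → (m, ((F α).2 n).1) ∈ (c n).2
  let d : ι → ℕ → ℕ := fun α n => Nat.findGreatest (Alive α n) (G n)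
  have halive : ∀ α β, α ≤ β → ∀ᶠ n in tail M, Alive α n ((F β).2 n).1 := fun α β hαβ => by
    rcases hαβ.eq_or_lt with rfl | hlt
    · filter_upwards [hnode α, (hMc α).2] with n h₁ h₂ m hm₁ hm₂
      rw [← h₂.2.snd _ _ (Nat.lt_succ_of_le hm₂), hm₂.antisymm hm₁]
      exact h₁.mem
    · filter_upwards [hlink α β hlt, (hMc β).2] with n h₁ h₂ m hm₁ hm₂
      exact (h₂.2.snd _ _ (Nat.lt_succ_of_le hm₂)).1 (h₁.alive m hm₁ hm₂)
  have hled : ∀ α β, α ≤ β → ∀ᶠ n in tail M, ((F β).2 n).1 ≤ d α n := fun α β hαβ => by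
    filter_upwards [halive α β hαβ, hnode β] with n h₁ h₂
    exact Nat.le_findGreatest (h₂.bounded.snd _ _ h₂.mem).1 h₁
  have hrd : ∀ α β, ∀ᶠ n in tail M, r β n ≤ d α n := fun α β => by
    have hr := (hF β).le.filter_mono (hMF β).tail_le
    rcases le_or_gt α β with h | h
    · filter_upwards [hr, hled α β h] with n h₁ h₂ using h₁.trans h₂
    · filter_upwards [hr, hlink β α h, hled α α le_rfl] with n h₁ h₂ h₃
      exact h₁.trans (h₂.lt.le.trans h₃)
  choose φ hφ using fun α => hg.exists_le (hK.trans_le pseudoNum_le_towerNum) hMN (hrd α)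
  refine ⟨φ, fun α β hαβ hφαβ hle => ?_⟩
  have hmem : ∀ δ, φ δ = φ α → ∀ᶠ n in tail M,
      (f (g α β) n, ((F δ).2 n).1) ∈ (c n).2 := fun δ hδ => by
    have hanti : ∀ᶠ n in tail M, f (g α β) n ≤ f (φ δ) n := by
      rcases hle.eq_or_lt with h | h
      · exact Eventually.of_forall fun n => by rw [hδ, h]
      · rw [hδ]
        exact (hg.anti _ _ h).filter_mono hMN.tail_le
    filter_upwards [hanti, hφ δ, halive δ δ le_rfl, hnode δ,
      ((hF δ).lt (g α β)).filter_mono (hMF δ).tail_le] with n h₁ h₂ h₃ h₄ h₅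
    exact Nat.findGreatest_spec (h₄.bounded.snd _ _ h₄.mem).1 h₃ _ h₅.le (h₁.trans h₂)
  have := hM.neBot_tail
  obtain ⟨n, h₁, h₂, h₃, h₄⟩ := ((hmem α rfl).and ((hmem β hφαβ.symm).and
    ((hlink α β hαβ).and (hMc β).2))).exists
  refine (h₄.1.lt _ _ _ _ h₃.lt ?_ h₁ h₂).false
  exact (h₄.2.fst _ _ _ (Nat.lt_succ_self _)).1 ((h₃.value _).2 rfl)

/-- The pseudointersection number equals the tower number. -/
theorem pseudoNum_eq_towerNum : pseudoNum = towerNum := by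
  refine pseudoNum_le_towerNum.antisymm (not_lt.1 fun h => ?_)
  have hcard : #pseudoNum.ord.ToType = pseudoNum := mk_ord_toType _
  have hIio : ∀ β : pseudoNum.ord.ToType, #(Iio β) < pseudoNum := fun β => by
    simpa using mk_Iio_lt β
  have hι : #pseudoNum.ord.ToType < towerNum := by rwa [hcard]
  obtain ⟨A, hA, hdir, hno⟩ := exists_directed_family
  obtain ⟨β, K, B, hKβ, hK, hKI, hBanti, hBA, hB⟩ := exists_descending_sequence hι hA hdir hno
  have hKp : #K < pseudoNum := (mk_le_mk_of_subset hKβ).trans_lt (hIio β)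
  have : Nonempty K := mk_ne_zero_iff.1 (aleph0_pos.trans_le hK).ne'
  have : Nonempty pseudoNum.ord.ToType := ⟨β⟩
  have hKι : #(K × pseudoNum.ord.ToType) < towerNum := by
    rw [mk_prod, lift_id, lift_id, hcard]
    exact (mul_le_of_le aleph0_lt_pseudoNum.le hKp.le le_rfl).trans_lt h
  obtain ⟨N, r, f, G, hg⟩ := exists_isGap (B := fun i : K => B i) (A := A) hKp hKι
    (fun i j hij => hBanti i i.2 j j.2 hij) (fun i => hBA i i.2)
    (fun ⟨X, hX⟩ => hB ⟨X, fun i hi => hX.1 ⟨i, hi⟩, hX.2⟩)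
  obtain ⟨g, hgφ⟩ := exists_coloring hK hKI (by rwa [hcard])
  obtain ⟨φ, hφ⟩ := hg.not_coloring hKp hIio hι g
  obtain ⟨α, β, h₁, h₂, h₃⟩ := hgφ φ
  exact hφ α β h₁ h₂ h₃
end

section
/- The tower number 𝔱 is less than or equal to the bounding number 𝔟. -/
open Cardinal Set

/-- `f ≤* g` : `f n ≤ g n` for all but finitely many `n`. -/
def EvLE (f g : ℕ → ℕ) : Prop := {n : ℕ | ¬ f n ≤ g n}.Finite

/-- The bounding number `𝔟`: least cardinality of a family of functions `ℕ → ℕ`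
not dominated by any single function. -/
noncomputable def boundingNum : Cardinal :=
  sInf { c | ∃ F : Set (ℕ → ℕ), (¬ ∃ g : ℕ → ℕ, ∀ f ∈ F, EvLE f g) ∧ c = #↥F }

/-- Every element of `X` bounds the values of `f` up to any smaller element of `X`. -/
def Outpaces (X : Set ℕ) (f : ℕ → ℕ) : Prop :=
  ∀ x ∈ X, ∀ y ∈ X, x < y → ∀ k ≤ x, f k ≤ y

theorem exists_infinite_subset_outpaces {P : Set ℕ} (hP : P.Infinite) (f : ℕ → ℕ) :
    ∃ X ⊆ P, X.Infinite ∧ Outpaces X f := by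
  choose s hsP hs using hP.exists_gt
  let step : ℕ → ℕ := fun a => s (a + ∑ k ∈ Finset.range (a + 1), f k)
  have hlt (a : ℕ) : a < step a := (Nat.le_add_right _ _).trans_lt (hs _)
  have hf (a k : ℕ) (hk : k ≤ a) : f k ≤ step a :=
    (Finset.single_le_sum (f := f) (fun _ _ => Nat.zero_le _)
      (Finset.mem_range.2 (Nat.lt_succ_of_le hk))).trans
      ((Nat.le_add_left _ _).trans (hs _).le)
  let a : ℕ → ℕ := fun n => step^[n] (s 0)
  have hsucc (n : ℕ) : a (n + 1) = step (a n) := Function.iterate_succ_apply' _ _ _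
  have hmono : StrictMono a := strictMono_nat_of_lt_succ fun n => by
    rw [hsucc]
    exact hlt _
  refine ⟨range a, ?_, infinite_range_of_injective hmono.injective, ?_⟩
  · rintro _ ⟨n, rfl⟩
    cases n with
    | zero => exact hsP 0
    | succ n =>
      rw [hsucc]
      exact hsP _
  · rintro _ ⟨i, rfl⟩ _ ⟨j, rfl⟩ hij k hk
    calc f k ≤ step (a i) := hf _ _ hk
      _ = a (i + 1) := (hsucc i).symm
      _ ≤ a j := hmono.monotone (hmono.lt_iff_lt.1 hij)

theorem exists_dominating_of_pseudointersection {A : Set ℕ} (hA : A.Infinite) :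
    ∃ g : ℕ → ℕ, ∀ (f : ℕ → ℕ) (X : Set ℕ), Outpaces X f → AlmostSubset A X → EvLE f g := by
  choose s hsA hs using hA.exists_gt
  refine ⟨fun n => s (s n), fun f X hX hAX => ?_⟩
  obtain ⟨N, hN⟩ := hAX.bddAbove
  refine (finite_Iic N).subset fun n hn => ?_
  by_contra hnN
  have hnN : N < n := not_le.1 hnN
  have mem (m : ℕ) (hm : m ∈ A) (hNm : N < m) : m ∈ X := by
    by_contra h
    exact absurd (hN ⟨hm, h⟩) (not_le.2 hNm)
  have h₁ := hnN.trans (hs n)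
  exact hn (hX _ (mem _ (hsA n) h₁) _ (mem _ (hsA _) (h₁.trans (hs _))) (hs _) _ (hs n).le)

theorem hasPseudointersection_of_lt_towerNum {F : Set (Set ℕ)} (hinf : ∀ A ∈ F, A.Infinite)
    (hlin : ∀ A ∈ F, ∀ B ∈ F, AlmostSubset A B ∨ AlmostSubset B A) (hF : #F < towerNum) :
    HasPseudointersection F := by
  by_contra h
  exact notMem_of_lt_csInf' hF ⟨F, hinf, hlin, h, rfl⟩

theorem AlmostSubset.refl (A : Set ℕ) : AlmostSubset A A := by
  simp [AlmostSubset]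

theorem AlmostSubset.of_subset_left {A B C : Set ℕ} (hAB : A ⊆ B) (hBC : AlmostSubset B C) :
    AlmostSubset A C :=
  hBC.subset (sdiff_subset_sdiff_left hAB)

theorem almostSubset_or_almostSubset_of_trichotomous {ι : Type*} {r : ι → ι → Prop}
    [IsWellOrder ι r] {A : ι → Set ℕ} {i j : ι} (hij : r i j → AlmostSubset (A j) (A i))
    (hji : r j i → AlmostSubset (A i) (A j)) :
    AlmostSubset (A i) (A j) ∨ AlmostSubset (A j) (A i) := by
  rcases trichotomous_of r i j with h | rfl | h
  · exact .inr (hij h)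
  · exact .inl (AlmostSubset.refl _)
  · exact .inl (hji h)

open Classical in
theorem exists_tower_outpacing {ι : Type} (f : ι → ℕ → ℕ) (hι : #ι < towerNum) :
    ∃ A : ι → Set ℕ, (∀ i, (A i).Infinite ∧ Outpaces (A i) (f i)) ∧
      ∀ i j, AlmostSubset (A i) (A j) ∨ AlmostSubset (A j) (A i) := by
  let r : ι → ι → Prop := WellOrderingRel
  have wf : WellFounded r := IsWellFounded.wf
  let Q (i : ι) (B : ∀ j, r j i → Set ℕ) (X : Set ℕ) : Prop :=
    (X.Infinite ∧ Outpaces X (f i)) ∧ ∀ j hj, AlmostSubset X (B j hj)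
  let A : ι → Set ℕ := wf.fix fun i B => if h : ∃ X, Q i B X then h.choose else ∅
  have key (i : ι) : Q i (fun j _ => A j) (A i) := by
    induction i using wf.induction with
    | h i ih =>
      have hex : ∃ X, Q i (fun j _ => A j) X := by
        obtain ⟨P, hP, hPA⟩ := hasPseudointersection_of_lt_towerNum (F := A '' {j | r j i})
          (by
            rintro _ ⟨j, hj, rfl⟩
            exact (ih j hj).1.1)
          (by
            rintro _ ⟨j, hj, rfl⟩ _ ⟨k, hk, rfl⟩
            exact almostSubset_or_almostSubset_of_trichotomous (r := r)
              ((ih k hk).2 j) ((ih j hj).2 k))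
          (mk_image_le.trans_lt ((mk_set_le _).trans_lt hι))
        obtain ⟨X, hXP, hX⟩ := exists_infinite_subset_outpaces hP (f i)
        exact ⟨X, hX, fun j hj => (hPA _ ⟨j, hj, rfl⟩).of_subset_left hXP⟩
      have hA : A i = hex.choose := by
        rw [show A i = _ from wf.fix_eq _ i]
        exact dif_pos hex
      rw [hA]
      exact hex.choose_spec
  exact ⟨A, fun i => (key i).1, fun i j =>
    almostSubset_or_almostSubset_of_trichotomous (r := r) ((key j).2 i) ((key i).2 j)⟩

theorem not_exists_forall_evLE : ¬ ∃ g : ℕ → ℕ, ∀ f ∈ (univ : Set (ℕ → ℕ)), EvLE f g := by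
  rintro ⟨g, hg⟩
  refine infinite_univ (α := ℕ) ((hg (fun n => g n + 1) (mem_univ _)).subset fun n _ => ?_)
  simp

/-- The tower number is at most the bounding number. -/
theorem towerNum_le_boundingNum : towerNum ≤ boundingNum := by
  refine le_csInf ⟨_, univ, not_exists_forall_evLE, rfl⟩ ?_
  rintro _ ⟨F, hF, rfl⟩
  by_contra hlt
  have hlt : #F < towerNum := not_le.1 hlt
  obtain ⟨A, hA, hlin⟩ := exists_tower_outpacing (fun f : F => (f : ℕ → ℕ)) hlt
  obtain ⟨P, hP, hPA⟩ := hasPseudointersection_of_lt_towerNum (F := range A)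
    (forall_mem_range.2 fun i => (hA i).1)
    (forall_mem_range.2 fun i => forall_mem_range.2 fun j => hlin i j)
    (mk_range_le.trans_lt hlt)
  obtain ⟨g, hg⟩ := exists_dominating_of_pseudointersection hP
  exact hF ⟨g, fun f hf => hg f _ (hA ⟨f, hf⟩).2 (hPA _ (mem_range_self _))⟩
end
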